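/- Let G be a finite group and let ρ : G → GL(V) be a finite-dimensional complex representation with character χ and kernel K = ker(ρ). Let L = ℚ(χ(g) : g ∈ G) be the subfield of ℂ generated over ℚ by the character values, which is a finite extension of ℚ. In the rational group algebra ℚ[G], define e = (dim V / |G|) · Σ_{g ∈ G} Tr_{L/ℚ}(χ(g⁻¹)) · g and p_K = (1/|K|) · Σ_{k ∈ K} k, where Tr_{L/ℚ} denotes the field trace of L over ℚ. Then p_K · e = e. -/

import Mathlib

/-- If a function on a finite group is invariant under left translation by `k`, then the
corresponding element of the group algebra is fixed by left multiplication by `k`. -/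
theorem MonoidAlgebra.of_mul_sum_smul_of_eq {R G : Type*} [CommSemiring R] [Group G] [Fintype G]
    (f : G → R) (k : G) (hf : ∀ g, f (k * g) = f g) :
    MonoidAlgebra.of R G k * ∑ g : G, f g • MonoidAlgebra.of R G g =
      ∑ g : G, f g • MonoidAlgebra.of R G g := by
  rw [Finset.mul_sum]
  refine Fintype.sum_equiv (Equiv.mulLeft k) _ _ fun g => ?_
  rw [Equiv.coe_mulLeft, hf, map_mul, mul_smul_comm]

/-- A representation is unchanged by right multiplication by the inverse of a kernel element. -/
theorem Representation.apply_mul_inv_of_apply_eq_one {R G V : Type*} [CommSemiring R] [Group G]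
    [AddCommMonoid V] [Module R V] (ρ : Representation R G V) {k : G} (hk : ρ k = 1) (g : G) :
    ρ (g * k⁻¹) = ρ g := by
  rw [← mul_one (ρ (g * k⁻¹)), ← hk, ← map_mul, inv_mul_cancel_right]

open scoped Classical in
/-- Let `ρ` be a finite-dimensional complex representation of a finite group `G`
with character `χ` and kernel `K = {k : G | ρ k = 1}`, and let
`L = ℚ(χ(g) : g ∈ G) ⊆ ℂ`, assumed to be a finite extension of `ℚ`. In the
rational group algebra `ℚ[G]`, with `e = (dim V / |G|) Σ_{g∈G} Tr_{L/ℚ}(χ(g⁻¹)) g`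
and `p_K = (1/|K|) Σ_{k∈K} k`, we have `p_K * e = e`. This is exactly the
computation of Lemma 4.1 of the paper. -/
theorem averaging_mul_rational_idempotent
    {G : Type*} [Group G] [Fintype G] {V : Type*} [AddCommGroup V]
    [Module ℂ V] [FiniteDimensional ℂ V] (ρ : Representation ℂ G V)
    (χ : G → ℂ) (hχ : ∀ g, χ g = LinearMap.trace ℂ V (ρ g))
    (L : IntermediateField ℚ ℂ)
    (hL : L = IntermediateField.adjoin ℚ (Set.range χ))
    [FiniteDimensional ℚ L]
    (hmem : ∀ g : G, χ g ∈ L) :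
    ((Nat.card {k : G // ρ k = 1} : ℚ)⁻¹ •
        ∑ k : {k : G // ρ k = 1}, MonoidAlgebra.of ℚ G (k : G)) *
        (((Module.finrank ℂ V : ℚ) / (Fintype.card G : ℚ)) •
          ∑ g : G, (Algebra.trace ℚ L ⟨χ g⁻¹, hmem g⁻¹⟩) • MonoidAlgebra.of ℚ G g) =
      ((Module.finrank ℂ V : ℚ) / (Fintype.card G : ℚ)) •
        ∑ g : G, (Algebra.trace ℚ L ⟨χ g⁻¹, hmem g⁻¹⟩) • MonoidAlgebra.of ℚ G g := by
  rw [mul_smul_comm]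
  congr 1
  have fixed (k : {k : G // ρ k = 1}) :=
    MonoidAlgebra.of_mul_sum_smul_of_eq
      (fun g : G => Algebra.trace ℚ L ⟨χ g⁻¹, hmem g⁻¹⟩) k fun g => by
        have h : χ ((k : G) * g)⁻¹ = χ g⁻¹ := by
          rw [hχ, hχ, mul_inv_rev, ρ.apply_mul_inv_of_apply_eq_one k.2]
        simp only [h]
  have card_ne_zero : (Nat.card {k : G // ρ k = 1} : ℚ) ≠ 0 := by
    have : Nonempty {k : G // ρ k = 1} := ⟨⟨1, map_one ρ⟩⟩
    exact Nat.cast_ne_zero.mpr Nat.card_pos.ne'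
  rw [smul_mul_assoc, Finset.sum_mul, Finset.sum_congr rfl fun k _ => fixed k,
    Finset.sum_const, Finset.card_univ, ← Nat.card_eq_fintype_card,
    ← Nat.cast_smul_eq_nsmul ℚ, inv_smul_smul₀ card_ne_zero]
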